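/- For every n ≥ 1, the elements {1,2,...,n-1} and {2,3,...,n} are left-modular in L_n: for each such m and all x < y in L_n, (x ∨ m) ∧ y = x ∨ (m ∧ y). -/

import Mathlib

open scoped Classical

/-- An arithmetic progression of integers: a finite set of the form
`{a, a+r, ..., a+(k-1)r}` with `a : ℤ`, `r ≥ 1` and `k ≥ 0` (so the empty set and all
singletons are arithmetic progressions). -/
def IsAP (s : Finset ℤ) : Prop :=
  ∃ (a r : ℤ) (k : ℕ), 1 ≤ r ∧ s = (Finset.range k).image (fun i => a + (i : ℤ) * r)

/-- The number `p_{nk}` of arithmetic progressions of cardinality `k` contained in `{1,…,n}`. -/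
noncomputable def numAP (n k : ℕ) : ℕ :=
  ((Finset.Icc (1:ℤ) (n:ℤ)).powerset.filter (fun s => IsAP s ∧ s.card = k)).card

/-- The Möbius function of the poset of arithmetic progressions ordered by inclusion,
defined by `μ(x,x) = 1` and `μ(x,y) = -∑_{x ≤ z < y} μ(x,z)`, where `z` ranges over
arithmetic progressions with `x ⊆ z ⊂ y`.  (For `x ⊆ y ⊆ {1,…,n}`, all arithmetic
progressions `z` with `x ⊆ z ⊂ y` automatically lie in `L_n`, so this is the Möbius
function of any interval `[x, y]` of the lattice `L_n`.) -/
noncomputable def apMu (x y : Finset ℤ) : ℤ :=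
  if x = y then 1
  else - ∑ z ∈ (y.powerset.filter (fun z => IsAP z ∧ x ⊆ z ∧ z ≠ y)).attach, apMu x z.1
termination_by y.card
decreasing_by
  rename_i z
  have hz := z.2
  rw [Finset.mem_filter, Finset.mem_powerset] at hz
  exact Finset.card_lt_card (lt_of_le_of_ne hz.1 hz.2.2.2)

/-- The join of `a` and `b` in the lattice of arithmetic progressions contained in `t`:
the intersection of all arithmetic progressions contained in `t` that contain `a ∪ b`,
i.e. the smallest such progression. -/
noncomputable def apJoin (t a b : Finset ℤ) : Finset ℤ :=
  t.filter (fun v => ∀ z : Finset ℤ, IsAP z → z ⊆ t → a ∪ b ⊆ z → v ∈ z)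

/-- The meet (intersection) of a finite family `S` of subsets of the top element `t`;
the meet of the empty family is `t` itself. -/
def apMeet (t : Finset ℤ) (S : Finset (Finset ℤ)) : Finset ℤ :=
  S.fold (· ⊓ ·) t id

/-- `x` is a coatom of the lattice `L_n` of arithmetic progressions contained in
`{1,…,n}`: an element distinct from the maximum `{1,…,n}` with no element strictly
between it and the maximum. -/
def IsCoatomIn (n : ℕ) (x : Finset ℤ) : Prop :=
  IsAP x ∧ x ⊆ Finset.Icc (1:ℤ) (n:ℤ) ∧ x ≠ Finset.Icc (1:ℤ) (n:ℤ) ∧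
    ∀ y : Finset ℤ, IsAP y → y ⊆ Finset.Icc (1:ℤ) (n:ℤ) → x ⊂ y → y = Finset.Icc (1:ℤ) (n:ℤ)

/-- `y` is covered by `top` in the poset of arithmetic progressions: `y < top` and there
is no arithmetic progression strictly between them. -/
def CoveredIn (top y : Finset ℤ) : Prop :=
  IsAP y ∧ y ⊂ top ∧ ¬ ∃ z : Finset ℤ, IsAP z ∧ y ⊂ z ∧ z ⊂ top

/-- `c` is a maximal chain in the lattice `L_n` of arithmetic progressions contained
in `{1,…,n}`: a chain (under inclusion) of elements of `L_n` to which no further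
element of `L_n` can be added. -/
def IsMaxChainIn (n : ℕ) (c : Finset (Finset ℤ)) : Prop :=
  (∀ s ∈ c, IsAP s ∧ s ⊆ Finset.Icc (1:ℤ) (n:ℤ)) ∧
  IsChain (· ⊆ ·) (↑c : Set (Finset ℤ)) ∧
  ∀ z : Finset ℤ, IsAP z → z ⊆ Finset.Icc (1:ℤ) (n:ℤ) →
    IsChain (· ⊆ ·) (insert z (↑c : Set (Finset ℤ))) → z ∈ c

/-- The number `b_{nk}` of chains of length `k` (i.e. totally ordered subsets with `k+1`
elements) in `L_n` that contain both `∅` and `{1,…,n}`. -/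
noncomputable def numChains (n k : ℕ) : ℕ :=
  (((Finset.Icc (1:ℤ) (n:ℤ)).powerset.filter IsAP).powerset.filter
    (fun c : Finset (Finset ℤ) => c.card = k + 1 ∧ ∅ ∈ c ∧ Finset.Icc (1:ℤ) (n:ℤ) ∈ c ∧
      IsChain (· ⊆ ·) (↑c : Set (Finset ℤ)))).card

/-- Membership form of `IsAP`. -/
theorem isAP_iff {s : Finset ℤ} : IsAP s ↔
    ∃ (a r : ℤ) (k : ℕ), 1 ≤ r ∧ ∀ v, v ∈ s ↔ ∃ i : ℕ, i < k ∧ a + (i : ℤ) * r = v := by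
  simp only [IsAP, Finset.ext_iff, Finset.mem_image, Finset.bind_def, Finset.pure_def,
    Finset.mem_sup, Finset.mem_singleton, Finset.mem_range]
  simp

theorem isAP_Icc (a b : ℤ) : IsAP (Finset.Icc a b) := by
  refine isAP_iff.2 ⟨a, 1, (b + 1 - a).toNat, le_rfl, fun v => ?_⟩
  rw [Finset.mem_Icc]
  constructor
  · rintro ⟨h1, h2⟩
    exact ⟨(v - a).toNat, by omega, by omega⟩
  · rintro ⟨i, hi, rfl⟩
    omega

/-- Removing an upper bound from an arithmetic progression leaves an arithmetic progression. -/
theorem IsAP.erase_of_forall_le {s : Finset ℤ} (hs : IsAP s) {c : ℤ} (hc : ∀ v ∈ s, v ≤ c) :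
    IsAP (s.erase c) := by
  by_cases hcs : c ∈ s
  swap
  · rwa [Finset.erase_eq_of_notMem hcs]
  obtain ⟨a, r, k, hr, hs⟩ := isAP_iff.1 hs
  obtain ⟨i, hi, rfl⟩ := (hs c).1 hcs
  have le_i : ∀ j < k, j ≤ i := fun j hj => by
    have h := hc _ ((hs _).2 ⟨j, hj, rfl⟩)
    by_contra! hlt
    have : (i : ℤ) < j := by exact_mod_cast hlt
    nlinarith
  refine isAP_iff.2 ⟨a, r, i, hr, fun v => ?_⟩
  rw [Finset.mem_erase, hs]
  constructor
  · rintro ⟨hne, j, hj, rfl⟩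
    exact ⟨j, lt_of_le_of_ne (le_i j hj) (by rintro rfl; exact hne rfl), rfl⟩
  · rintro ⟨j, hj, rfl⟩
    have : (j : ℤ) < i := by exact_mod_cast hj
    exact ⟨by nlinarith, j, hj.trans hi, rfl⟩

/-- Removing a lower bound from an arithmetic progression leaves an arithmetic progression. -/
theorem IsAP.erase_of_forall_ge {s : Finset ℤ} (hs : IsAP s) {c : ℤ} (hc : ∀ v ∈ s, c ≤ v) :
    IsAP (s.erase c) := by
  by_cases hcs : c ∈ s
  swap
  · rwa [Finset.erase_eq_of_notMem hcs]
  obtain ⟨a, r, k, hr, hs⟩ := isAP_iff.1 hs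
  obtain ⟨i, hi, hic⟩ := (hs c).1 hcs
  have h := hc _ ((hs _).2 ⟨0, Nat.zero_lt_of_lt hi, rfl⟩)
  have hca : c = a := by
    have : 0 ≤ (i : ℤ) * r := by positivity
    push_cast at h
    linarith
  subst hca
  refine isAP_iff.2 ⟨c + r, r, k - 1, hr, fun v => ?_⟩
  rw [Finset.mem_erase, hs]
  constructor
  · rintro ⟨hne, j, hj, rfl⟩
    cases j with
    | zero => simp at hne
    | succ j => exact ⟨j, by omega, by push_cast; ring⟩
  · rintro ⟨j, hj, rfl⟩
    have : 0 ≤ (j : ℤ) * r := by positivity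
    exact ⟨by linarith, j + 1, by omega, by push_cast; ring⟩

/-- If the union of two sets is an arithmetic progression, it is their join. -/
theorem apJoin_eq_union {t a b : Finset ℤ} (h : IsAP (a ∪ b)) (ht : a ∪ b ⊆ t) :
    apJoin t a b = a ∪ b := by
  ext v
  simp only [apJoin, Finset.mem_filter]
  exact ⟨fun hv => hv.2 _ h ht subset_rfl, fun hv => ⟨ht hv, fun _ _ _ hz => hz hv⟩⟩

/-- An element `t.erase c` whose meet with every element below `t` is an arithmetic progression
is left-modular. -/
theorem apJoin_erase_inter {t x y : Finset ℤ} {c : ℤ} (ht : IsAP t) (hm : IsAP (t.erase c))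
    (hy : IsAP y) (hyc : IsAP (y.erase c)) (hyt : y ⊆ t) (hxy : x ⊆ y) :
    apJoin t x (t.erase c) ∩ y = apJoin t x (t.erase c ∩ y) := by
  have hinter : t.erase c ∩ y = y.erase c := by
    rw [Finset.erase_inter, Finset.inter_eq_right.2 hyt]
  rw [hinter]
  by_cases hcx : c ∈ x
  · have h1 : x ∪ t.erase c = t := by
      ext v
      have := @hxy v
      have := @hyt v
      by_cases hv : v = c <;> simp_all
    have h2 : x ∪ y.erase c = y := by
      ext v
      have := @hxy v
      by_cases hv : v = c <;> simp_all
    rw [apJoin_eq_union (by rwa [h1]) h1.subset, apJoin_eq_union (by rwa [h2]) (by rwa [h2]),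
      h1, h2, Finset.inter_eq_right.2 hyt]
  · have h1 : x ∪ t.erase c = t.erase c :=
      Finset.union_eq_right.2 (Finset.subset_erase.2 ⟨hxy.trans hyt, hcx⟩)
    have h2 : x ∪ y.erase c = y.erase c :=
      Finset.union_eq_right.2 (Finset.subset_erase.2 ⟨hxy, hcx⟩)
    rw [apJoin_eq_union (by rwa [h1]) (by rw [h1]; exact Finset.erase_subset _ _),
      apJoin_eq_union (by rwa [h2]) (by rw [h2]; exact (Finset.erase_subset _ _).trans hyt),
      h1, h2, hinter]


/-- For `n ≥ 1`, the elements `{1,…,n-1}` and `{2,…,n}` are left-modular in `L_n`: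
for all `x < y` in `L_n`, `(x ∨ m) ∧ y = x ∨ (m ∧ y)`. -/
theorem leftModular_elements (n : ℕ) (hn : 1 ≤ n) (m : Finset ℤ)
    (hm : m = Finset.Icc (1:ℤ) ((n:ℤ) - 1) ∨ m = Finset.Icc (2:ℤ) (n:ℤ)) :
    ∀ x y : Finset ℤ, IsAP x → x ⊆ Finset.Icc (1:ℤ) (n:ℤ) →
      IsAP y → y ⊆ Finset.Icc (1:ℤ) (n:ℤ) → x ⊂ y →
      apJoin (Finset.Icc (1:ℤ) (n:ℤ)) x m ∩ y
        = apJoin (Finset.Icc (1:ℤ) (n:ℤ)) x (m ∩ y) := by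
  intro x y _ _ hy hyt hxy
  rcases hm with rfl | rfl
  · have h : Finset.Icc (1:ℤ) ((n:ℤ) - 1) = (Finset.Icc (1:ℤ) (n:ℤ)).erase n := by
      ext v
      simp only [Finset.mem_Icc, Finset.mem_erase]
      omega
    have hm := h ▸ isAP_Icc 1 ((n:ℤ) - 1)
    rw [h]
    exact apJoin_erase_inter (isAP_Icc _ _) hm hy
      (hy.erase_of_forall_le fun v hv => (Finset.mem_Icc.1 (hyt hv)).2) hyt hxy.subset
  · have h : Finset.Icc (2:ℤ) (n:ℤ) = (Finset.Icc (1:ℤ) (n:ℤ)).erase 1 := by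
      ext v
      simp only [Finset.mem_Icc, Finset.mem_erase]
      omega
    have hm := h ▸ isAP_Icc 2 (n:ℤ)
    rw [h]
    exact apJoin_erase_inter (isAP_Icc _ _) hm hy
      (hy.erase_of_forall_ge fun v hv => (Finset.mem_Icc.1 (hyt hv)).1) hyt hxy.subset
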